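/- arXiv:1311.2219 — 4 statements merged into one kernel-verified Lean document; each statement's English description precedes it below -/
import Mathlib

section
/- Let R ⊆ S be orders on the finite set X with Φ(S) ⊆ R. Then the map T ↦ T − R is an isomorphism of partially ordered sets from the open interval ]R,S[ = {T ∈ Ω_X : R ⊂ T ⊂ S} onto the poset of proper nonempty subsets of S − R, ordered by inclusion; its inverse is B ↦ R ∪ B. -/
open scoped BigOperators ContinuousMap

variable {X : Type*}

/-- A relation `R ⊆ X × X` is an order: reflexive, transitive, antisymmetric. -/
def IsOrder (R : Set (X × X)) : Prop :=
  (∀ x : X, (x, x) ∈ R) ∧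
  (∀ x y z : X, (x, y) ∈ R → (y, z) ∈ R → (x, z) ∈ R) ∧
  (∀ x y : X, (x, y) ∈ R → (y, x) ∈ R → x = y)

/-- The opposite relation. -/
def opRel (R : Set (X × X)) : Set (X × X) := {p | (p.2, p.1) ∈ R}

/-- The equality relation `Δ` on `X`. -/
def delta (X : Type*) : Set (X × X) := {p | p.1 = p.2}

/-- `(x, y)` is an adjacent pair for `S` : `x <_S y` and `]x, y[_S = ∅`. -/
def Adjacent (S : Set (X × X)) (x y : X) : Prop :=
  (x, y) ∈ S ∧ x ≠ y ∧ ∀ z : X, (x, z) ∈ S → x ≠ z → (z, y) ∈ S → z ≠ y → False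

/-- The order `R` is maximal in the order `S`. -/
def IsMaximalIn (R S : Set (X × X)) : Prop :=
  IsOrder R ∧ R ⊂ S ∧ ∀ T : Set (X × X), IsOrder T → R ⊂ T → ¬ T ⊂ S

/-- The order `R^(2)` on `X × X` : `(x,y) ≤ (x',y')` iff `x ≤_R x'` and `y' ≤_R y`. -/
def le2 (R : Set (X × X)) (p q : X × X) : Prop := (p.1, q.1) ∈ R ∧ (q.2, p.2) ∈ R

/-- `p` is a minimal element of `(X × X) − (R ∪ R^op)` for the relation `R^(2)`. -/
def MinimalPair (R : Set (X × X)) (p : X × X) : Prop :=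
  p ∉ R ∪ opRel R ∧ ∀ q : X × X, q ∉ R ∪ opRel R → le2 R q p → q = p

/-- The Frattini subrelation of `S` : the intersection (inside `S`) of all
maximal order subrelations of `S`. -/
def frattiniRel (S : Set (X × X)) : Set (X × X) :=
  {p ∈ S | ∀ R : Set (X × X), IsMaximalIn R S → p ∈ R}

/-- Composition of relations. -/
def composeRel (R S : Set (X × X)) : Set (X × X) := {p | ∃ z : X, (p.1, z) ∈ R ∧ (z, p.2) ∈ S}

/-- The transitive closure of a relation: the smallest transitive relation containing it. -/
def transClosure (U : Set (X × X)) : Set (X × X) :=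
  {p | Relation.TransGen (fun a b => (a, b) ∈ U) p.1 p.2}

/-- `]·, x[_R`. -/
def lowerSet (R : Set (X × X)) (x : X) : Set X := {z | (z, x) ∈ R ∧ z ≠ x}

/-- `]x, ·[_R`. -/
def upperSet (R : Set (X × X)) (x : X) : Set X := {z | (x, z) ∈ R ∧ x ≠ z}

/-- The set `𝓔_R`. -/
def eSet (R : Set (X × X)) : Set (X × X) :=
  {p | p ∉ R ∪ opRel R ∧ lowerSet R p.1 ⊆ lowerSet R p.2 ∧ upperSet R p.2 ⊆ upperSet R p.1}

/-- The geometric realization of the order complex (nerve) of a poset `P`: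
convex combinations of elements of `P` whose support is a chain. -/
def orderComplex (P : Type*) [PartialOrder P] : Set (P → ℝ) :=
  {f | (∀ p, 0 ≤ f p) ∧ (∑ᶠ p, f p) = 1 ∧ IsChain (· ≤ ·) {p | f p ≠ 0}}

/-- Removing an adjacent pair from an order leaves an order. -/
theorem IsOrder.diff_singleton_of_adjacent {S : Set (X × X)} (hS : IsOrder S) {a b : X}
    (hab : Adjacent S a b) : IsOrder (S \ {(a, b)}) := by
  obtain ⟨hrefl, htrans, hanti⟩ := hS
  obtain ⟨-, hne, hadj⟩ := hab
  refine ⟨fun x => ⟨hrefl x, ?_⟩, ?_, fun x y hx hy => hanti x y hx.1 hy.1⟩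
  · rintro h
    obtain ⟨rfl, rfl⟩ := Prod.mk.inj h
    exact hne rfl
  · rintro x y z ⟨hxy, hxy'⟩ ⟨hyz, hyz'⟩
    refine ⟨htrans x y z hxy hyz, fun h => ?_⟩
    obtain ⟨rfl, rfl⟩ := Prod.mk.inj h
    exact hadj y hxy (fun h => hyz' (by rw [h]; rfl)) hyz (fun h => hxy' (by rw [h]; rfl))

/-- In a finite order, every order subrelation that omits a pair omits an adjacent pair. -/
theorem exists_adjacent_notMem [Finite X] {M S : Set (X × X)} (hM : IsOrder M) (hS : IsOrder S)
    {x y : X} (hxy : (x, y) ∈ S) (hxyM : (x, y) ∉ M) :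
    ∃ a b : X, Adjacent S a b ∧ (a, b) ∉ M := by
  induction hn : {z | (x, z) ∈ S ∧ (z, y) ∈ S}.ncard using Nat.strong_induction_on
    generalizing x y with
  | _ n ih =>
    subst hn
    by_cases hadj : Adjacent S x y
    · exact ⟨x, y, hadj, hxyM⟩
    have hne : x ≠ y := by
      rintro rfl
      exact hxyM (hM.1 x)
    obtain ⟨z, hxz, hxz', hzy, hzy'⟩ :
        ∃ z, (x, z) ∈ S ∧ x ≠ z ∧ (z, y) ∈ S ∧ z ≠ y := by
      by_contra! h
      exact hadj ⟨hxy, hne, fun z h1 h2 h3 h4 => h4 (h z h1 h2 h3)⟩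
    by_cases hxzM : (x, z) ∈ M
    · refine ih _ (Set.ncard_lt_ncard ?_ (Set.toFinite _)) hzy
        (fun h => hxyM (hM.2.1 x z y hxzM h)) rfl
      exact ⟨fun w hw => ⟨hS.2.1 x z w hxz hw.1, hw.2⟩,
        fun h => hxz' (hS.2.2 x z hxz (h ⟨hS.1 x, hxy⟩).1)⟩
    · refine ih _ (Set.ncard_lt_ncard ?_ (Set.toFinite _)) hxz hxzM rfl
      exact ⟨fun w hw => ⟨hw.1, hS.2.1 w z y hw.2 hzy⟩,
        fun h => hzy' (hS.2.2 z y hzy (h ⟨hxy, hS.1 y⟩).2)⟩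

/-- A pair that is not adjacent belongs to the Frattini subrelation. -/
theorem mem_frattiniRel_of_between [Finite X] {S : Set (X × X)} (hS : IsOrder S) {x y z : X}
    (hxz : (x, z) ∈ S) (hxz' : x ≠ z) (hzy : (z, y) ∈ S) (hzy' : z ≠ y) :
    (x, y) ∈ frattiniRel S := by
  have hxy := hS.2.1 x z y hxz hzy
  refine ⟨hxy, fun M ⟨hM, hMS, hmax⟩ => ?_⟩
  by_contra hxyM
  obtain ⟨a, b, hab, habM⟩ := exists_adjacent_notMem hM hS hxy hxyM
  have hne : (x, y) ≠ (a, b) := by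
    rintro h
    obtain ⟨rfl, rfl⟩ := Prod.mk.inj h
    exact hab.2.2 z hxz hxz' hzy hzy'
  refine hmax _ (hS.diff_singleton_of_adjacent hab) ⟨?_, fun h => hxyM (h ⟨hxy, hne⟩)⟩
    ⟨Set.sdiff_subset, fun h => (h hab.1).2 rfl⟩
  exact fun p hp => ⟨hMS.1 hp, fun h => habM (h ▸ hp)⟩

/-- Every relation between `R` and `S` is an order when `R` contains the Frattini subrelation. -/
theorem isOrder_of_frattiniRel_subset [Finite X] {R S T : Set (X × X)} (hR : IsOrder R)
    (hS : IsOrder S) (hphi : frattiniRel S ⊆ R) (hRT : R ⊆ T) (hTS : T ⊆ S) : IsOrder T := by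
  refine ⟨fun x => hRT (hR.1 x), fun x y z hxy hyz => ?_,
    fun x y hxy hyx => hS.2.2 x y (hTS hxy) (hTS hyx)⟩
  rcases eq_or_ne x y with rfl | h
  · exact hyz
  rcases eq_or_ne y z with rfl | h'
  · exact hxy
  exact hRT (hphi (mem_frattiniRel_of_between hS (hTS hxy) h (hTS hyz) h'))

/-- Theorem 4.1(2), second part: if `Φ(S) ⊆ R`, the map `T ↦ T − R` is an isomorphism
of posets from `]R, S[` onto the poset of proper nonempty subsets of `S − R`,
with inverse `B ↦ R ∪ B`. -/
theorem interval_orderIso_properSubsets {X : Type*} [Fintype X]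
    (R S : Set (X × X)) (hR : IsOrder R) (hS : IsOrder S) (hRS : R ⊆ S)
    (hphi : frattiniRel S ⊆ R) :
    ∃ e : {T : Set (X × X) // IsOrder T ∧ R ⊂ T ∧ T ⊂ S} ≃o
          {B : Set (X × X) // B ⊂ S \ R ∧ B ≠ ∅},
      (∀ T, (e T : Set (X × X)) = (T : Set (X × X)) \ R) ∧
      (∀ B, (e.symm B : Set (X × X)) = R ∪ (B : Set (X × X))) := by
  refine ⟨{
    toFun := fun T => ⟨T.1 \ R, ?_, ?_⟩
    invFun := fun B => ⟨R ∪ B.1, ?_, ?_, ?_⟩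
    left_inv := ?_
    right_inv := ?_
    map_rel_iff' := ?_ }, fun _ => rfl, fun _ => rfl⟩
  · obtain ⟨T, -, hRT, hTS⟩ := T
    refine ⟨Set.sdiff_subset_sdiff_left hTS.1, fun h => hTS.2 fun p hp => ?_⟩
    by_cases hpR : p ∈ R
    · exact hRT.1 hpR
    · exact (h ⟨hp, hpR⟩).1
  · exact fun h => T.2.2.1.2 (Set.sdiff_eq_empty.mp h)
  · exact isOrder_of_frattiniRel_subset hR hS hphi Set.subset_union_left
      (Set.union_subset hRS fun p hp => (B.2.1.1 hp).1)
  · obtain ⟨B, hB, hne⟩ := B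
    obtain ⟨p, hp⟩ := Set.nonempty_iff_ne_empty.mpr hne
    exact ⟨Set.subset_union_left, fun h => (hB.1 hp).2 (h (Or.inr hp))⟩
  · obtain ⟨B, hB, hne⟩ := B
    exact ⟨Set.union_subset hRS fun p hp => (hB.1 hp).1,
      fun h => hB.2 fun p hp => (h hp.1).resolve_left hp.2⟩
  · rintro ⟨T, -, hRT, -⟩
    exact Subtype.ext (Set.union_sdiff_cancel hRT.1)
  · rintro ⟨B, hB, -⟩
    exact Subtype.ext (Set.union_sdiff_cancel_left fun p hp => (hB.1 hp.2).2 hp.1)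
  · rintro ⟨T, -, hRT, -⟩ ⟨T', -, hRT', -⟩
    refine ⟨fun h p hp => ?_, fun h => Set.sdiff_subset_sdiff_left h⟩
    by_cases hpR : p ∈ R
    · exact hRT'.1 hpR
    · exact (h ⟨hp, hpR⟩).1
end

section
/- Let R ⊆ S be orders on the finite set X. The Möbius function μ of the finite partially ordered set Ω_X satisfies: μ(R,S) = 0 if Φ(S) ⊄ R, and μ(R,S) = (−1)^{|S−R|} if Φ(S) ⊆ R. -/
open scoped BigOperators ContinuousMap

variable {X : Type*}

/-- Removing an adjacent pair from an order leaves an order. -/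
lemma IsOrder.diff_adjacent {S : Set (X × X)} (hS : IsOrder S) {a b : X} (h : Adjacent S a b) :
    IsOrder (S \ {(a, b)}) := by
  obtain ⟨hrefl, htrans, hanti⟩ := hS
  obtain ⟨-, hne, hemp⟩ := h
  refine ⟨fun x => ⟨hrefl x, ?_⟩, fun x y z hxy hyz => ⟨htrans x y z hxy.1 hyz.1, ?_⟩,
    fun x y hxy hyx => hanti x y hxy.1 hyx.1⟩
  · simp only [Set.mem_singleton_iff, Prod.mk.injEq]
    rintro ⟨rfl, rfl⟩
    exact hne rfl
  · simp only [Set.mem_singleton_iff, Prod.mk.injEq]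
    rintro ⟨rfl, rfl⟩
    refine hemp y hxy.1 ?_ hyz.1 ?_
    · rintro rfl
      exact hyz.2 rfl
    · rintro rfl
      exact hxy.2 rfl

lemma isMaximalIn_diff_adjacent {S : Set (X × X)} (hS : IsOrder S) {a b : X}
    (h : Adjacent S a b) : IsMaximalIn (S \ {(a, b)}) S := by
  refine ⟨hS.diff_adjacent h, Set.sdiff_singleton_ssubset.2 h.1, fun T _ hT hTS => hTS.2 ?_⟩
  obtain ⟨p, hpT, hp⟩ := Set.exists_of_ssubset hT
  have hpab : p = (a, b) := by
    by_contra hne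
    exact hp ⟨hTS.1 hpT, hne⟩
  intro q hq
  by_cases hqab : q = (a, b)
  · rwa [hqab, ← hpab]
  · exact hT.1 ⟨hq, hqab⟩

/-- A finite order is generated, as an order, by its adjacent pairs. -/
lemma IsOrder.subset_of_adjacent [Finite X] {R S : Set (X × X)} (hR : IsOrder R)
    (hS : IsOrder S) (h : ∀ a b, Adjacent S a b → (a, b) ∈ R) : S ⊆ R := by
  suffices ∀ n : ℕ, ∀ x y, {z | (x, z) ∈ S ∧ (z, y) ∈ S}.ncard = n → (x, y) ∈ S →
      (x, y) ∈ R from fun p hp => this _ p.1 p.2 rfl hp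
  intro n
  induction n using Nat.strong_induction_on with
  | _ n ih =>
    rintro x y rfl hxy
    by_cases hne : x = y
    · exact hne ▸ hR.1 x
    by_cases hadj : Adjacent S x y
    · exact h x y hadj
    obtain ⟨z, hxz, hxz', hzy, hzy'⟩ :
        ∃ z, (x, z) ∈ S ∧ x ≠ z ∧ (z, y) ∈ S ∧ z ≠ y := by
      by_contra! hcon
      exact hadj ⟨hxy, hne, fun z h1 h2 h3 h4 => h4 (hcon z h1 h2 h3)⟩
    refine hR.2.1 x z y (ih _ (Set.ncard_lt_ncard ?_) x z rfl hxz)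
      (ih _ (Set.ncard_lt_ncard ?_) z y rfl hzy)
    · refine Set.ssubset_iff_exists.2 ⟨fun w hw => ⟨hw.1, hS.2.1 _ _ _ hw.2 hzy⟩, y,
        ⟨hxy, hS.1 y⟩, fun hy => hzy' (hS.2.2 _ _ hzy hy.2)⟩
    · refine Set.ssubset_iff_exists.2 ⟨fun w hw => ⟨hS.2.1 _ _ _ hxz hw.1, hw.2⟩, x,
        ⟨hS.1 x, hxy⟩, fun hx => hxz' (hS.2.2 _ _ hxz hx.1)⟩

/-- The Frattini subrelation consists of the non-adjacent pairs. -/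
lemma mem_frattiniRel_iff [Finite X] {S : Set (X × X)} (hS : IsOrder S) {p : X × X} :
    p ∈ frattiniRel S ↔ p ∈ S ∧ ¬ Adjacent S p.1 p.2 := by
  refine and_congr_right fun hp => ⟨fun h hadj => ?_, fun hadj M hM => ?_⟩
  · exact (h _ (isMaximalIn_diff_adjacent hS hadj)).2 rfl
  · obtain ⟨a, b, hab, habM⟩ : ∃ a b, Adjacent S a b ∧ (a, b) ∉ M := by
      by_contra! hcon
      exact hM.2.1.2 (hM.1.subset_of_adjacent hS hcon)
    by_contra hpM
    refine hM.2.2 _ (hS.diff_adjacent hab) (Set.ssubset_iff_exists.2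
      ⟨fun q hq => ⟨hM.2.1.1 hq, ?_⟩, p, ⟨hp, ?_⟩, hpM⟩) (Set.sdiff_singleton_ssubset.2 hab.1)
    · rintro rfl
      exact habM hq
    · rintro rfl
      exact hadj hab

/-- Every relation between `Φ(S)` and `S` is an order. -/
lemma IsOrder.of_frattiniRel_subset [Finite X] {S T : Set (X × X)} (hS : IsOrder S)
    (hΦ : frattiniRel S ⊆ T) (hT : T ⊆ S) : IsOrder T := by
  refine ⟨fun x => hΦ ((mem_frattiniRel_iff hS).2 ⟨hS.1 x, fun h => h.2.1 rfl⟩),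
    fun x y z hxy hyz => ?_, fun x y hxy hyx => hS.2.2 x y (hT hxy) (hT hyx)⟩
  by_cases h1 : x = y
  · exact h1 ▸ hyz
  by_cases h2 : y = z
  · exact h2 ▸ hxy
  exact hΦ ((mem_frattiniRel_iff hS).2 ⟨hS.2.1 x y z (hT hxy) (hT hyz),
    fun h => h.2.2 y (hT hxy) h1 (hT hyz) h2⟩)

/-- If the order `R ⊆ S` together with `Φ(S)` covers `S`, then `R = S`. -/
lemma IsOrder.eq_of_subset_union_frattiniRel [Finite X] {R S : Set (X × X)} (hR : IsOrder R)
    (hS : IsOrder S) (hRS : R ⊆ S) (h : S ⊆ R ∪ frattiniRel S) : R = S :=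
  hRS.antisymm <| hR.subset_of_adjacent hS fun _ _ hab =>
    (h hab.1).resolve_right fun hΦ => ((mem_frattiniRel_iff hS).1 hΦ).2 hab

open Classical in
/-- The alternating sum over a nontrivial interval of a finite power set vanishes. -/
lemma sum_neg_one_pow_ncard_diff_eq_zero {α : Type*} [Fintype α] {A B : Set α} (hAB : A ⊂ B) :
    ∑ V : Set α with A ⊆ V ∧ V ⊆ B, (-1 : ℤ) ^ (B \ V).ncard = 0 := by
  obtain ⟨a, haB, haA⟩ := Set.exists_of_ssubset hAB
  have hins : ∀ V : Set α, a ∈ V → V ⊆ B →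
      (-1 : ℤ) ^ (B \ V).ncard + (-1) ^ (B \ (V \ {a})).ncard = 0 := by
    intro V haV _
    have : B \ (V \ {a}) = insert a (B \ V) := by
      ext x
      by_cases hx : x = a <;> simp [hx, haB]
    rw [this, Set.ncard_insert_of_notMem (fun h => h.2 haV)]
    ring
  refine Finset.sum_involution (fun V _ => if a ∈ V then V \ {a} else insert a V) ?_ ?_ ?_ ?_
  · intro V hV
    simp only [Finset.mem_filter, Finset.mem_univ, true_and] at hV
    split_ifs with haV
    · exact hins V haV hV.2
    · have := hins (insert a V) (Set.mem_insert a V) (Set.insert_subset haB hV.2)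
      rwa [Set.insert_sdiff_self_of_notMem haV, add_comm] at this
  · intro V _ _ heq
    split_ifs at heq with haV
    · rw [← heq] at haV
      exact haV.2 rfl
    · exact haV (heq ▸ Set.mem_insert a V)
  · intro V hV
    simp only [Finset.mem_filter, Finset.mem_univ, true_and] at hV ⊢
    split_ifs with haV
    · exact ⟨Set.subset_sdiff_singleton hV.1 haA, Set.sdiff_subset.trans hV.2⟩
    · exact ⟨hV.1.trans (Set.subset_insert a V), Set.insert_subset haB hV.2⟩
  · intro V _
    by_cases haV : a ∈ V
    · simp [haV]
    · simp [haV]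

open Classical in
/-- The function `(T, S) ↦ (-1) ^ |S - T|` if `Φ(S) ⊆ T`, and `0` otherwise, is a right inverse of
the zeta function of the poset of orders. -/
lemma sum_frattiniRel_subset_neg_one_pow [Fintype X] {S T : Set (X × X)} (hS : IsOrder S)
    (hT : IsOrder T) (hTS : T ⊆ S) :
    ∑ V : Set (X × X) with IsOrder V ∧ T ⊆ V ∧ V ⊆ S,
      (if frattiniRel S ⊆ V then (-1 : ℤ) ^ (S \ V).ncard else 0) = if T = S then 1 else 0 := by
  have hfilter : ({V : Set (X × X) | IsOrder V ∧ T ⊆ V ∧ V ⊆ S} : Finset _).filter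
      (fun V => frattiniRel S ⊆ V) =
        ({V : Set (X × X) | T ∪ frattiniRel S ⊆ V ∧ V ⊆ S} : Finset _) := by
    ext V
    simp only [Finset.mem_filter, Finset.mem_univ, true_and, Set.union_subset_iff]
    exact ⟨fun h => ⟨⟨h.1.2.1, h.2⟩, h.1.2.2⟩,
      fun h => ⟨⟨hS.of_frattiniRel_subset h.1.2 h.2, h.1.1, h.2⟩, h.1.2⟩⟩
  have hΦ : frattiniRel S ⊆ S := fun _ h => h.1
  rw [← Finset.sum_filter, hfilter]
  split_ifs with heq
  · subst heq
    rw [Finset.sum_eq_single_of_mem T]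
    · simp
    · simpa using hΦ
    · intro V hV hne
      simp only [Finset.mem_filter, Finset.mem_univ, true_and, Set.union_subset_iff] at hV
      exact absurd (hV.2.antisymm hV.1.1) hne
  · exact sum_neg_one_pow_ncard_diff_eq_zero ⟨Set.union_subset hTS hΦ,
      fun h => heq (hT.eq_of_subset_union_frattiniRel hS hTS h)⟩

/-- Corollary 4.2: the Möbius function of the poset of posets, defined by `μ(R, R) = 1`
and `∑_{R ⊆ T ⊆ S} μ(R, T) = 0` for `R ⊂ S`, satisfies `μ(R, S) = 0` if `Φ(S) ⊄ R`,
and `μ(R, S) = (−1)^{|S − R|}` if `Φ(S) ⊆ R`. -/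
theorem mobius_poset_of_posets {X : Type*} [Fintype X]
    (mu : Set (X × X) → Set (X × X) → ℤ)
    (hmu1 : ∀ T : Set (X × X), IsOrder T → mu T T = 1)
    (hmu2 : ∀ T U : Set (X × X), IsOrder T → IsOrder U → T ⊂ U →
      (∑ᶠ V ∈ {V : Set (X × X) | IsOrder V ∧ T ⊆ V ∧ V ⊆ U}, mu T V) = 0)
    (R S : Set (X × X)) (hR : IsOrder R) (hS : IsOrder S) (hRS : R ⊆ S) :
    (¬ frattiniRel S ⊆ R → mu R S = 0) ∧
    (frattiniRel S ⊆ R → mu R S = (-1) ^ (S \ R).ncard) := by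
  classical
  set f : Set (X × X) → ℤ := fun V => if frattiniRel S ⊆ V then (-1) ^ (S \ V).ncard else 0
    with hf
  have hzeta : ∀ V : Set (X × X), IsOrder V → R ⊆ V →
      ∑ T : Set (X × X) with IsOrder T ∧ R ⊆ T ∧ T ⊆ V, mu R T = if R = V then 1 else 0 := by
    intro V hV hRV
    split_ifs with heq
    · subst heq
      rw [Finset.sum_eq_single_of_mem R (by simpa using hR), hmu1 R hR]
      intro T hT hne
      simp only [Finset.mem_filter, Finset.mem_univ, true_and] at hT
      exact absurd (hT.2.2.antisymm hT.2.1) hne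
    · rw [← hmu2 R V hR hV (hRV.ssubset_of_ne heq), finsum_mem_eq_sum_of_inter_support_eq]
      simp
  have key : mu R S = f R := calc
    mu R S = ∑ T : Set (X × X) with IsOrder T ∧ R ⊆ T ∧ T ⊆ S,
        mu R T * if T = S then 1 else 0 := by
      rw [Finset.sum_eq_single_of_mem S (by simp [hS, hRS])]
      · simp
      · intro T _ hne
        simp [hne]
    _ = ∑ T : Set (X × X) with IsOrder T ∧ R ⊆ T ∧ T ⊆ S,
        ∑ V : Set (X × X) with IsOrder V ∧ T ⊆ V ∧ V ⊆ S, mu R T * f V := by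
      refine Finset.sum_congr rfl fun T hT => ?_
      simp only [Finset.mem_filter, Finset.mem_univ, true_and] at hT
      rw [← sum_frattiniRel_subset_neg_one_pow hS hT.1 hT.2.2, Finset.mul_sum]
    _ = ∑ V : Set (X × X) with IsOrder V ∧ R ⊆ V ∧ V ⊆ S,
        ∑ T : Set (X × X) with IsOrder T ∧ R ⊆ T ∧ T ⊆ V, mu R T * f V := by
      refine Finset.sum_comm' fun T V => ?_
      simp only [Finset.mem_filter, Finset.mem_univ, true_and]
      exact ⟨fun h => ⟨⟨h.1.1, h.1.2.1, h.2.2.1⟩, h.2.1, h.1.2.1.trans h.2.2.1, h.2.2.2⟩,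
        fun h => ⟨⟨h.1.1, h.1.2.1, h.1.2.2.trans h.2.2.2⟩, h.2.1, h.1.2.2, h.2.2.2⟩⟩
    _ = ∑ V : Set (X × X) with IsOrder V ∧ R ⊆ V ∧ V ⊆ S, (if R = V then 1 else 0) * f V := by
      refine Finset.sum_congr rfl fun V hV => ?_
      simp only [Finset.mem_filter, Finset.mem_univ, true_and] at hV
      rw [← Finset.sum_mul, hzeta V hV.1 hV.2.1]
    _ = f R := by
      rw [Finset.sum_eq_single_of_mem R (by simp [hR, hRS])]
      · simp
      · intro V _ hne
        simp [hne.symm]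
  exact ⟨fun h => by simp [key, hf, h], fun h => by simp [key, hf, h]⟩
end

section
/- Let R be an order on the finite set X with 𝓔_R = (𝓔_R)^op, so that E_R = Δ ∪ 𝓔_R is an equivalence relation on X; let X_1, …, X_r be its equivalence classes. For each i, let T_i ⊆ X_i × X_i be an order on X_i (reflexive on X_i, transitive and antisymmetric). Then R ∪ T_1 ∪ … ∪ T_r is an order on X. -/
open scoped BigOperators ContinuousMap

variable {X : Type*}

/-- If `𝓔_R` is symmetric, two elements are `E_R`-equivalent exactly when they have the same
strict lower bounds and the same strict upper bounds. -/
theorem mem_delta_union_eSet_iff {X : Type*} {R : Set (X × X)}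
    (hsym : eSet R = opRel (eSet R)) (a b : X) :
    (a, b) ∈ delta X ∪ eSet R ↔ lowerSet R a = lowerSet R b ∧ upperSet R a = upperSet R b := by
  constructor
  · rintro (h | h)
    · obtain rfl : a = b := h
      exact ⟨rfl, rfl⟩
    · have h' : (b, a) ∈ eSet R := by
        rw [hsym] at h
        exact h
      exact ⟨h.2.1.antisymm h'.2.1, h'.2.2.antisymm h.2.2⟩
  · rintro ⟨hl, hu⟩
    by_cases hab : a = b
    · exact Or.inl hab
    · refine Or.inr ⟨?_, hl.subset, hu.symm.subset⟩
      rintro (h | h)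
      · have : a ∈ lowerSet R a := hl ▸ (⟨h, hab⟩ : a ∈ lowerSet R b)
        exact this.2 rfl
      · have : a ∈ upperSet R a := hu ▸ (⟨h, Ne.symm hab⟩ : a ∈ upperSet R b)
        exact this.2 rfl

/-- The Claim in the proof of Theorem 5.3: if `𝓔_R = (𝓔_R)^op` and, for each equivalence
class `C` of `E_R = Δ ∪ 𝓔_R`, `T C` is an order on `C`, then `R ∪ ⋃ T C` is an order on `X`. -/
theorem union_orders_on_classes_isOrder {X : Type*} [Fintype X]
    (R : Set (X × X)) (hR : IsOrder R) (hsym : eSet R = opRel (eSet R))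
    (T : Set X → Set (X × X))
    (hT : ∀ C ∈ {C : Set X | ∃ a : X, C = {b : X | (a, b) ∈ delta X ∪ eSet R}},
      T C ⊆ C ×ˢ C ∧ (∀ a ∈ C, (a, a) ∈ T C) ∧
      (∀ x y z : X, (x, y) ∈ T C → (y, z) ∈ T C → (x, z) ∈ T C) ∧
      (∀ x y : X, (x, y) ∈ T C → (y, x) ∈ T C → x = y)) :
    IsOrder (R ∪ ⋃ C ∈ {C : Set X | ∃ a : X, C = {b : X | (a, b) ∈ delta X ∪ eSet R}}, T C) := by
  let cls : X → Set X := fun a => {b : X | (a, b) ∈ delta X ∪ eSet R}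
  have mem_cls (a b : X) : b ∈ cls a ↔
      lowerSet R a = lowerSet R b ∧ upperSet R a = upperSet R b :=
    mem_delta_union_eSet_iff hsym a b
  have cls_eq {a b : X} (h : b ∈ cls a) : cls a = cls b := by
    obtain ⟨hl, hu⟩ := (mem_cls a b).1 h
    ext c
    rw [mem_cls, mem_cls, hl, hu]
  have hT' (a : X) := hT (cls a) ⟨a, rfl⟩
  have mem_union_iff (x y : X) :
      (x, y) ∈ R ∪ ⋃ C ∈ {C : Set X | ∃ a : X, C = {b : X | (a, b) ∈ delta X ∪ eSet R}}, T C ↔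
        (x, y) ∈ R ∨ (x, y) ∈ T (cls x) := by
    refine or_congr Iff.rfl (Set.mem_iUnion₂.trans ⟨?_, fun h => ⟨cls x, ⟨x, rfl⟩, h⟩⟩)
    rintro ⟨C, ⟨a, rfl⟩, h⟩
    rw [← cls_eq ((hT' a).1 h).1]
    exact h
  have mem_of_T {x y : X} (h : (x, y) ∈ T (cls x)) : y ∈ cls x := ((hT' x).1 h).2
  obtain ⟨hrefl, htrans, hanti⟩ := hR
  have eq_of_R_of_T {x y : X} (h : (x, y) ∈ R) (h' : (y, x) ∈ T (cls y)) : x = y := by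
    by_contra hne
    have hx : x ∈ lowerSet R y := ⟨h, hne⟩
    rw [((mem_cls y x).1 (mem_of_T h')).1] at hx
    exact hx.2 rfl
  refine ⟨fun x => Or.inl (hrefl x), fun x y z => ?_, fun x y => ?_⟩
  · simp only [mem_union_iff]
    rintro (h | h) (h' | h')
    · exact Or.inl (htrans x y z h h')
    · by_cases hxy : x = y
      · subst hxy
        exact Or.inr h'
      · have hx : x ∈ lowerSet R y := ⟨h, hxy⟩
        rw [((mem_cls y z).1 (mem_of_T h')).1] at hx
        exact Or.inl hx.1
    · by_cases hyz : y = z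
      · subst hyz
        exact Or.inr h
      · have hz : z ∈ upperSet R y := ⟨h', hyz⟩
        rw [← ((mem_cls x y).1 (mem_of_T h)).2] at hz
        exact Or.inl hz.1
    · rw [← cls_eq (mem_of_T h)] at h'
      exact Or.inr ((hT' x).2.2.1 x y z h h')
  · simp only [mem_union_iff]
    rintro (h | h) (h' | h')
    · exact hanti x y h h'
    · exact eq_of_R_of_T h h'
    · exact (eq_of_R_of_T h' h).symm
    · rw [← cls_eq (mem_of_T h)] at h'
      exact (hT' x).2.2.2 x y h h'
end

section
/- Let X be a finite set of cardinality n ≥ 2. Then the poset Ω_X − {Δ} of nontrivial orders on X, ordered by inclusion, has the homotopy type of a sphere of dimension n − 2: the geometric realization of its order complex is homotopy equivalent to the sphere S^{n−2}. -/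
open scoped BigOperators ContinuousMap

variable {X : Type*}

/-- Order relations with truth values in `[0, 1]`: every superlevel set `{p | u ≤ τ p}`
with `0 < u ≤ 1` is a nontrivial order. -/
def fuzzyOrders (X : Type*) : Set (X × X → ℝ) :=
  {τ | (∀ p, 0 ≤ τ p ∧ τ p ≤ 1) ∧ (∀ x, τ (x, x) = 1) ∧
    (∀ x y z, min (τ (x, y)) (τ (y, z)) ≤ τ (x, z)) ∧
    (∀ x y, x ≠ y → τ (x, y) = 0 ∨ τ (y, x) = 0) ∧ ∃ x y, x ≠ y ∧ τ (x, y) = 1}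

/-- The height function of a fuzzy order: the fuzzy cardinality of the principal lower sets. -/
def height [Fintype X] (τ : X × X → ℝ) (x : X) : ℝ := ∑ z, τ (z, x)

theorem continuous_height [Fintype X] : Continuous (height : (X × X → ℝ) → X → ℝ) :=
  continuous_pi fun _ => continuous_finsetSum _ fun _ _ => continuous_apply _

theorem one_le_height_sub [Fintype X] {τ : X × X → ℝ} (hτ : τ ∈ fuzzyOrders X) {x y : X}
    (hxy : x ≠ y) (h : τ (x, y) = 1) : 1 ≤ height τ y - height τ x := by
  classical
  obtain ⟨h01, hrefl, htrans, hanti, -⟩ := hτ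
  have hmono : ∀ z, τ (z, x) ≤ τ (z, y) := fun z => by
    have := htrans z x y
    rwa [h, min_eq_left (h01 _).2] at this
  have hyx : τ (y, x) = 0 := (hanti x y hxy).resolve_left (by simp [h])
  rw [height, height, ← Finset.sum_sub_distrib]
  calc (1 : ℝ) = τ (y, y) - τ (y, x) := by simp [hrefl, hyx]
    _ ≤ _ := Finset.single_le_sum (f := fun z => τ (z, y) - τ (z, x))
      (fun z _ => sub_nonneg.2 (hmono z)) (Finset.mem_univ y)

open Classical in
/-- The fuzzy order whose superlevel set at `u` is the semiorder `u * c ≤ v y - v x`. -/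
noncomputable def semiorder (v : X → ℝ) (c : ℝ) (p : X × X) : ℝ :=
  if p.1 = p.2 then 1 else max 0 (min 1 ((v p.2 - v p.1) / c))

theorem semiorder_eq_one {v : X → ℝ} {c : ℝ} (hc : 0 < c) {x y : X} (h : c ≤ v y - v x) :
    semiorder v c (x, y) = 1 := by
  have : 1 ≤ (v y - v x) / c := (one_le_div hc).2 h
  simp [semiorder, this]

theorem semiorder_eq_zero {v : X → ℝ} {c : ℝ} (hc : 0 < c) {x y : X} (hxy : x ≠ y)
    (h : v y ≤ v x) : semiorder v c (x, y) = 0 := by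
  have : (v y - v x) / c ≤ 0 := div_nonpos_of_nonpos_of_nonneg (by linarith) hc.le
  simp [semiorder, hxy, this]

theorem semiorder_mem_Icc (v : X → ℝ) (c : ℝ) (p : X × X) :
    0 ≤ semiorder v c p ∧ semiorder v c p ≤ 1 := by
  unfold semiorder
  split_ifs <;> simp

theorem semiorder_mem {v : X → ℝ} {c : ℝ} (hc : 0 < c) (h : ∃ x y, c ≤ v y - v x) :
    semiorder v c ∈ fuzzyOrders X := by
  refine ⟨semiorder_mem_Icc v c, fun x => by simp [semiorder], fun x y z => ?_,
    fun x y hxy => ?_, ?_⟩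
  · by_cases hxy : x = y
    · subst hxy
      exact min_le_right _ _
    by_cases hyz : y = z
    · subst hyz
      exact min_le_left _ _
    rcases le_total (v y) (v x) with h1 | h1
    · rw [semiorder_eq_zero hc hxy h1]
      exact (min_le_left _ _).trans (semiorder_mem_Icc v c _).1
    rcases le_total (v z) (v y) with h2 | h2
    · rw [semiorder_eq_zero hc hyz h2]
      exact (min_le_right _ _).trans (semiorder_mem_Icc v c _).1
    by_cases hxz : x = z
    · subst hxz
      rw [show semiorder v c (x, x) = 1 by simp [semiorder]]
      exact (min_le_left _ _).trans (semiorder_mem_Icc v c _).2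
    refine (min_le_left _ _).trans ?_
    simp only [semiorder, hxy, hxz, if_false]
    gcongr
  · rcases le_total (v y) (v x) with h1 | h1
    · exact .inl (semiorder_eq_zero hc hxy h1)
    · exact .inr (semiorder_eq_zero hc hxy.symm h1)
  · obtain ⟨x, y, h⟩ := h
    refine ⟨x, y, ?_, semiorder_eq_one hc h⟩
    rintro rfl
    linarith

theorem min_mem_fuzzyOrders {τ σ : X × X → ℝ} (hτ : τ ∈ fuzzyOrders X) (hσ : σ ∈ fuzzyOrders X)
    (h : ∀ x y, x ≠ y → τ (x, y) = 1 → σ (x, y) = 1) : τ ⊓ σ ∈ fuzzyOrders X := by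
  refine ⟨fun p => ⟨le_min (hτ.1 p).1 (hσ.1 p).1, (min_le_left _ _).trans (hτ.1 p).2⟩,
    fun x => ?_, fun x y z => ?_, fun x y hxy => ?_, ?_⟩
  · simp [hτ.2.1, hσ.2.1]
  · simp only [Pi.inf_apply]
    refine le_min (le_trans ?_ (hτ.2.2.1 x y z)) (le_trans ?_ (hσ.2.2.1 x y z))
    · exact min_le_min (min_le_left _ _) (min_le_left _ _)
    · exact min_le_min (min_le_right _ _) (min_le_right _ _)
  · simp only [Pi.inf_apply]
    exact (hτ.2.2.2.1 x y hxy).imp (fun h => by rw [h]; exact min_eq_left (hσ.1 _).1)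
      (fun h => by rw [h]; exact min_eq_left (hσ.1 _).1)
  · obtain ⟨x, y, hxy, h1⟩ := hτ.2.2.2.2
    exact ⟨x, y, hxy, by simp [h1, h x y hxy h1]⟩

theorem max_min_mem_fuzzyOrders {π τ : X × X → ℝ} (hπ : π ∈ fuzzyOrders X)
    (hτ : τ ∈ fuzzyOrders X) (h : π ≤ τ) (s : ℝ) :
    (fun p => max (π p) (min (τ p) s)) ∈ fuzzyOrders X := by
  have hle : ∀ p, max (π p) (min (τ p) s) ≤ τ p := fun p => max_le (h p) (min_le_left _ _)
  have hge : ∀ p, 0 ≤ max (π p) (min (τ p) s) := fun p => (hπ.1 p).1.trans (le_max_left _ _)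
  refine ⟨fun p => ⟨hge p, (hle p).trans (hτ.1 p).2⟩, fun x => ?_, fun x y z => ?_,
    fun x y hxy => ?_, ?_⟩
  · simp [hπ.2.1, hτ.2.1]
  · have h1 := hπ.2.2.1 x y z
    have h2 := hτ.2.2.1 x y z
    have h3 := h (x, y)
    have h4 := h (y, z)
    grind
  · exact (hτ.2.2.2.1 x y hxy).imp (fun h => ((hle _).trans_eq h).antisymm (hge _))
      (fun h => ((hle _).trans_eq h).antisymm (hge _))
  · obtain ⟨x, y, hxy, h1⟩ := hπ.2.2.2.2
    exact ⟨x, y, hxy, by simp [h1, (hτ.1 _).2]⟩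

/-- Extension of a vector by a zero coordinate. -/
def zeroExtend {m : ℕ} (e : Option (Fin m) ≃ X) (v : EuclideanSpace ℝ (Fin m)) (x : X) : ℝ :=
  (e.symm x).elim 0 v

/-- The coordinates of a function relative to its value at a base point. -/
def relCoords {m : ℕ} (e : Option (Fin m) ≃ X) (w : X → ℝ) : EuclideanSpace ℝ (Fin m) :=
  WithLp.toLp 2 fun i => w (e (some i)) - w (e none)

theorem zeroExtend_relCoords {m : ℕ} (e : Option (Fin m) ≃ X) (w : X → ℝ) (x : X) :
    zeroExtend e (relCoords e w) x = w x - w (e none) := by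
  obtain ⟨o, rfl⟩ := e.surjective x
  cases o <;> simp [zeroExtend, relCoords]

theorem zeroExtend_add_smul {m : ℕ} (e : Option (Fin m) ≃ X) (a b : ℝ)
    (v w : EuclideanSpace ℝ (Fin m)) (x : X) :
    zeroExtend e (a • v + b • w) x = a * zeroExtend e v x + b * zeroExtend e w x := by
  obtain ⟨o, rfl⟩ := e.surjective x
  cases o <;> simp [zeroExtend]

theorem continuous_zeroExtend {m : ℕ} (e : Option (Fin m) ≃ X) : Continuous (zeroExtend e) := by
  refine continuous_pi fun x => ?_
  obtain ⟨o, rfl⟩ := e.surjective x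
  cases o
  · simpa [zeroExtend] using continuous_const
  · simp only [zeroExtend, Equiv.symm_apply_apply, Option.elim]
    fun_prop

theorem continuous_relCoords {m : ℕ} (e : Option (Fin m) ≃ X) : Continuous (relCoords e) := by
  unfold relCoords
  fun_prop

/-- The threshold of the semiorder attached to a nonzero vector. -/
noncomputable def threshold [Fintype X] {m : ℕ} (e : Option (Fin m) ≃ X)
    (v : EuclideanSpace ℝ (Fin m)) : ℝ := min 1 ‖zeroExtend e v‖

theorem threshold_pos [Fintype X] {m : ℕ} (e : Option (Fin m) ≃ X)
    {v : EuclideanSpace ℝ (Fin m)} (hv : v ≠ 0) : 0 < threshold e v := by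
  refine lt_min one_pos (norm_pos_iff.2 fun h => hv ?_)
  ext i
  simpa [zeroExtend] using congrFun h (e (some i))

theorem exists_threshold_le [Fintype X] {m : ℕ} (e : Option (Fin m) ≃ X)
    (v : EuclideanSpace ℝ (Fin m)) :
    ∃ x y, threshold e v ≤ zeroExtend e v y - zeroExtend e v x := by
  have : Nonempty X := ⟨e none⟩
  obtain ⟨x, hx⟩ := Finite.exists_max fun x => ‖zeroExtend e v x‖
  have h0 : zeroExtend e v (e none) = 0 := by simp [zeroExtend]
  have h1 : threshold e v ≤ |zeroExtend e v x| :=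
    (min_le_right _ _).trans ((pi_norm_le_iff_of_nonneg (norm_nonneg _)).2 hx)
  rcases le_total 0 (zeroExtend e v x) with h | h
  · exact ⟨e none, x, by rwa [h0, sub_zero, ← abs_of_nonneg h]⟩
  · exact ⟨x, e none, by rwa [h0, zero_sub, ← abs_of_nonpos h]⟩

/-- The vector of relative heights of a fuzzy order. -/
def fuzzyToVector [Fintype X] {m : ℕ} (e : Option (Fin m) ≃ X) :
    C(fuzzyOrders X, ({0}ᶜ : Set (EuclideanSpace ℝ (Fin m)))) where
  toFun τ := ⟨relCoords e (height τ), fun h => by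
    obtain ⟨x, y, hxy, h1⟩ := τ.2.2.2.2.2
    have h2 := one_le_height_sub τ.2 hxy h1
    have h3 : ∀ z, height τ.1 z - height τ.1 (e none) = 0 := fun z => by
      rw [← zeroExtend_relCoords, Set.mem_singleton_iff.1 h]
      obtain ⟨o, rfl⟩ := e.surjective z
      cases o <;> simp [zeroExtend]
    linarith [h3 x, h3 y]⟩
  continuous_toFun := ((continuous_relCoords e).comp
    (continuous_height.comp continuous_subtype_val)).subtype_mk _

/-- The fuzzy order of semiorders attached to a nonzero vector. -/
noncomputable def vectorToFuzzy [Fintype X] {m : ℕ} (e : Option (Fin m) ≃ X) :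
    C(({0}ᶜ : Set (EuclideanSpace ℝ (Fin m))), fuzzyOrders X) where
  toFun v := ⟨semiorder (zeroExtend e v) (threshold e v),
    semiorder_mem (threshold_pos e v.2) (exists_threshold_le e v)⟩
  continuous_toFun := by
    refine Continuous.subtype_mk (continuous_pi fun p => ?_) _
    have h : Continuous fun v : ({0}ᶜ : Set (EuclideanSpace ℝ (Fin m))) => zeroExtend e v.1 :=
      (continuous_zeroExtend e).comp continuous_subtype_val
    unfold semiorder
    split_ifs
    · exact continuous_const
    · refine continuous_const.max (continuous_const.min (Continuous.div ?_ ?_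
        fun v => (threshold_pos e v.2).ne'))
      · exact (continuous_pi_iff.1 h _).sub (continuous_pi_iff.1 h _)
      · exact continuous_const.min h.norm

theorem vectorToFuzzy_fuzzyToVector_eq_one [Fintype X] {m : ℕ} (e : Option (Fin m) ≃ X)
    (τ : fuzzyOrders X) {x y : X} (hxy : x ≠ y) (h : τ.1 (x, y) = 1) :
    (vectorToFuzzy e (fuzzyToVector e τ)).1 (x, y) = 1 := by
  refine semiorder_eq_one (threshold_pos e (fuzzyToVector e τ).2) ((min_le_left _ _).trans ?_)
  simpa [fuzzyToVector, zeroExtend_relCoords] using one_le_height_sub τ.2 hxy h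

/-- Fuzzy orders on `X` are homotopy equivalent to a punctured Euclidean space. -/
noncomputable def fuzzyOrdersHomotopyEquiv [Fintype X] {m : ℕ} (e : Option (Fin m) ≃ X) :
    fuzzyOrders X ≃ₕ ({0}ᶜ : Set (EuclideanSpace ℝ (Fin m))) where
  toFun := fuzzyToVector e
  invFun := vectorToFuzzy e
  left_inv := by
    let ρ : C(fuzzyOrders X, fuzzyOrders X) := (vectorToFuzzy e).comp (fuzzyToVector e)
    have hρ : ∀ τ : fuzzyOrders X, τ.1 ⊓ (ρ τ).1 ∈ fuzzyOrders X := fun τ =>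
      min_mem_fuzzyOrders τ.2 (ρ τ).2 fun x y hxy h =>
        vectorToFuzzy_fuzzyToVector_eq_one e τ hxy h
    have happ : ∀ (φ : C(fuzzyOrders X, fuzzyOrders X)) (p : X × X),
        Continuous fun τ => (φ τ).1 p := fun φ p =>
      (continuous_apply p).comp (continuous_subtype_val.comp φ.continuous)
    obtain ⟨κ, hκ⟩ : ∃ κ : C(fuzzyOrders X, fuzzyOrders X), ∀ τ, (κ τ).1 = τ.1 ⊓ (ρ τ).1 :=
      ⟨⟨fun τ => ⟨τ.1 ⊓ (ρ τ).1, hρ τ⟩, Continuous.subtype_mk (continuous_pi fun p =>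
        (happ (.id _) p).min (happ ρ p)) _⟩, fun _ => rfl⟩
    have key : ∀ φ : C(fuzzyOrders X, fuzzyOrders X), (∀ τ, (κ τ).1 ≤ (φ τ).1) →
        κ.Homotopic φ := fun φ hφ => ⟨{
      toFun := fun q => ⟨_, max_min_mem_fuzzyOrders (κ q.2).2 (φ q.2).2 (hφ q.2) q.1⟩
      continuous_toFun := by
        refine Continuous.subtype_mk (continuous_pi fun p => ?_) _
        exact ((happ κ p).comp continuous_snd).max (((happ φ p).comp continuous_snd).min
          (continuous_subtype_val.comp continuous_fst))
      map_zero_left := fun τ => by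
        ext p
        simp [((κ τ).2.1 p).1, ((φ τ).2.1 p).1]
      map_one_left := fun τ => by
        ext p
        simp [((φ τ).2.1 p).2, hφ τ p] }⟩
    exact (key ρ fun τ => (hκ τ).trans_le inf_le_right).symm.trans (key (.id _) fun τ => (hκ τ).trans_le inf_le_left)
  right_inv := by
    refine .symm ⟨{
      toFun := fun q => ⟨(1 - q.1.1) • q.2.1 +
        q.1.1 • (fuzzyToVector e (vectorToFuzzy e q.2)).1, fun h => ?_⟩
      continuous_toFun := by
        have h : Continuous fun v => (fuzzyToVector e (vectorToFuzzy e v)).1 :=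
          continuous_subtype_val.comp ((fuzzyToVector e).comp (vectorToFuzzy e)).continuous
        exact Continuous.subtype_mk
          (((continuous_const.sub (continuous_subtype_val.comp continuous_fst)).smul
            (continuous_subtype_val.comp continuous_snd)).add
            ((continuous_subtype_val.comp continuous_fst).smul (h.comp continuous_snd))) _
      map_zero_left := fun v => by simp
      map_one_left := fun v => by simp }⟩
    obtain ⟨⟨s, hs0, hs1⟩, v⟩ := q
    obtain ⟨x, y, hxy⟩ := exists_threshold_le e v.1
    have hc := threshold_pos e v.2
    have hne : x ≠ y := by
      rintro rfl
      linarith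
    have h1 := one_le_height_sub (vectorToFuzzy e v).2 hne (semiorder_eq_one hc hxy)
    have h2 : ∀ z, (1 - s) * zeroExtend e v.1 z + s * (height (vectorToFuzzy e v).1 z -
        height (vectorToFuzzy e v).1 (e none)) = 0 := fun z => by
      rw [← zeroExtend_relCoords, ← zeroExtend_add_smul]
      erw [Set.mem_singleton_iff.1 h]
      obtain ⟨o, rfl⟩ := e.surjective z
      cases o <;> simp [zeroExtend]
    have h3 := h2 x
    have h4 := h2 y
    rcases hs1.lt_or_eq with hs | rfl
    · nlinarith [mul_pos (sub_pos.2 hs) (hc.trans_le hxy)]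
    · linarith

/-- A punctured normed space is homotopy equivalent to its unit sphere. -/
noncomputable def puncturedHomotopyEquivSphere (E : Type*) [NormedAddCommGroup E]
    [NormedSpace ℝ E] : ({0}ᶜ : Set E) ≃ₕ Metric.sphere (0 : E) 1 :=
  have : ContractibleSpace (Set.Ioi (0 : ℝ)) :=
    (convex_Ioi 0).contractibleSpace Set.nonempty_Ioi
  (homeomorphUnitSphereProd E).toHomotopyEquiv.trans <|
    ((ContinuousMap.HomotopyEquiv.refl _).prodCongr
      (ContractibleSpace.hequiv_unit _).some).trans (Homeomorph.prodPUnit _).toHomotopyEquiv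

theorem isCompact_orderComplex (P : Type*) [PartialOrder P] [Finite P] :
    IsCompact (orderComplex P) := by
  have := Fintype.ofFinite P
  have hK : orderComplex P = stdSimplex ℝ P ∩
      ⋂ (p : P) (q : P) (_ : ¬ (p ≤ q ∨ q ≤ p)), {f | f p * f q = 0} := by
    ext f
    simp only [orderComplex, stdSimplex, finsum_eq_sum_of_fintype, Set.mem_ofPred_eq,
      Set.mem_inter_iff, Set.mem_iInter, mul_eq_zero, and_assoc, and_congr_right_iff]
    refine fun _ _ => ⟨fun h p q hpq => ?_, fun h p hp q hq _ => ?_⟩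
    · by_contra! hne
      exact hpq (h.total hne.1 hne.2)
    · by_contra hpq
      exact (h p q hpq).elim hp hq
  rw [hK]
  refine (isCompact_stdSimplex ℝ P).inter_right ?_
  exact isClosed_iInter fun p => isClosed_iInter fun q => isClosed_iInter fun _ =>
    isClosed_eq (by fun_prop) continuous_const

open Classical in
theorem eq_of_sum_ge_eq {P : Type*} [PartialOrder P] [Fintype P] {f g : P → ℝ}
    (h : ∀ p, ∑ q with p ≤ q, f q = ∑ q with p ≤ q, g q) : f = g := by
  funext p
  induction p using WellFoundedGT.induction with
  | ind p ih =>
    have hins : Finset.univ.filter (p ≤ ·) = insert p (Finset.univ.filter (p < ·)) := by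
      ext q
      simp [le_iff_eq_or_lt, eq_comm]
    have hp := h p
    rw [hins, Finset.sum_insert (by simp), Finset.sum_insert (by simp),
      Finset.sum_congr rfl fun q hq => ih q (Finset.mem_filter.1 hq).2] at hp
    exact add_right_cancel hp

/-- The nontrivial orders on `X`. -/
abbrev NontrivialOrder (X : Type*) := {T : Set (X × X) // IsOrder T ∧ T ≠ delta X}

theorem NontrivialOrder.exists_ne (S : NontrivialOrder X) : ∃ x y, x ≠ y ∧ (x, y) ∈ S.1 := by
  by_contra! h
  refine S.2.2 (Set.Subset.antisymm (fun p hp => ?_) fun p hp => ?_)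
  · by_contra hne
    exact h _ _ hne hp
  · rw [show p = (p.1, p.1) from Prod.ext rfl (Eq.symm hp)]
    exact S.2.1.1 _

noncomputable instance [Finite X] : Fintype (NontrivialOrder X) := Fintype.ofFinite _

open Classical in
/-- The total mass of the orders that contain a given pair. -/
noncomputable def pairMass [Finite X] (t : NontrivialOrder X → ℝ) (p : X × X) : ℝ :=
  ∑ S with p ∈ S.1, t S

theorem continuous_pairMass [Finite X] :
    Continuous (pairMass : (NontrivialOrder X → ℝ) → X × X → ℝ) :=
  continuous_pi fun _ => continuous_finsetSum _ fun _ _ => continuous_apply _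

open Classical in
theorem pairMass_mem [Finite X] {t : NontrivialOrder X → ℝ}
    (ht : t ∈ orderComplex (NontrivialOrder X)) : pairMass t ∈ fuzzyOrders X := by
  obtain ⟨h0, h1, hchain⟩ := ht
  rw [finsum_eq_sum_of_fintype] at h1
  have hone : ∀ p, (∀ S, t S ≠ 0 → p ∈ S.1) → pairMass t p = 1 := fun p hp => by
    rw [pairMass, Finset.sum_filter_of_ne fun S _ => hp S, h1]
  have hle : ∀ p q : X × X, (∀ S, t S ≠ 0 → p ∈ S.1 → q ∈ S.1) → pairMass t p ≤ pairMass t q :=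
    fun p q hpq => by
      rw [pairMass, pairMass, Finset.sum_filter, Finset.sum_filter]
      refine Finset.sum_le_sum fun S _ => ?_
      by_cases hS : t S = 0
      · simp [hS]
      by_cases hp : p ∈ S.1
      · simp [hp, hpq S hS hp]
      · simp only [hp, if_false]
        split_ifs
        exacts [h0 S, le_rfl]
  refine ⟨fun p => ⟨Finset.sum_nonneg fun S _ => h0 S, ?_⟩,
    fun x => hone _ fun S _ => S.2.1.1 x, fun x y z => ?_, fun x y hxy => ?_, ?_⟩
  · rw [← h1]
    exact Finset.sum_le_sum_of_subset_of_nonneg (Finset.filter_subset _ _) fun S _ _ => h0 S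
  · rw [min_le_iff]
    by_contra! h
    have h2 := mt (hle (x, y) (x, z)) h.1.not_ge
    have h3 := mt (hle (y, z) (x, z)) h.2.not_ge
    push Not at h2 h3
    obtain ⟨S, hS, hxy, hxz⟩ := h2
    obtain ⟨R, hR, hyz, hxz'⟩ := h3
    rcases hchain.total hS hR with hSR | hRS
    · exact hxz' (R.2.1.2.1 x y z (hSR hxy) hyz)
    · exact hxz (S.2.1.2.1 x y z hxy (hRS hyz))
  · by_contra! h
    obtain ⟨S, hS, hS0⟩ := Finset.exists_ne_zero_of_sum_ne_zero h.1
    obtain ⟨R, hR, hR0⟩ := Finset.exists_ne_zero_of_sum_ne_zero h.2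
    rw [Finset.mem_filter] at hS hR
    rcases hchain.total hS0 hR0 with hSR | hRS
    · exact hxy (R.2.1.2.2 x y (hSR hS.2) hR.2)
    · exact hxy (S.2.1.2.2 x y hS.2 (hRS hR.2))
  · obtain ⟨S, -, hS⟩ := Finset.exists_ne_zero_of_sum_ne_zero (h1.trans_ne one_ne_zero)
    obtain ⟨R, hR, hmin⟩ := (Set.toFinite {S | t S ≠ 0}).exists_minimal ⟨S, hS⟩
    obtain ⟨x, y, hxy, hRxy⟩ := R.exists_ne
    refine ⟨x, y, hxy, hone _ fun Q hQ => ?_⟩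
    rcases hchain.total hR hQ with h | h
    · exact h hRxy
    · exact hmin hQ h hRxy

open Classical in
theorem sum_ge_le_pairMass [Finite X] {t : NontrivialOrder X → ℝ} (h0 : ∀ S, 0 ≤ t S)
    (S : NontrivialOrder X) {p : X × X} (hp : p ∈ S.1) : ∑ R with S ≤ R, t R ≤ pairMass t p :=
  Finset.sum_le_sum_of_subset_of_nonneg
    (Finset.monotone_filter_right _ fun _ _ hR => hR hp) fun R _ _ => h0 R

open Classical in
theorem exists_pairMass_eq_sum_ge [Finite X] {t : NontrivialOrder X → ℝ}
    (hchain : IsChain (· ≤ ·) {S | t S ≠ 0}) (S : NontrivialOrder X) :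
    ∃ p ∈ S.1, pairMass t p = ∑ R with S ≤ R, t R := by
  suffices h : ∃ p ∈ S.1, ∀ R, t R ≠ 0 → p ∈ R.1 → S ≤ R by
    obtain ⟨p, hp, h⟩ := h
    refine ⟨p, hp, ?_⟩
    rw [pairMass, Finset.sum_filter, Finset.sum_filter]
    refine Finset.sum_congr rfl fun R _ => ?_
    by_cases hR : t R = 0
    · simp [hR]
    · exact if_congr ⟨h R hR, fun hSR => hSR hp⟩ rfl rfl
  by_cases hne : {R | t R ≠ 0 ∧ ¬ S ≤ R}.Nonempty
  · obtain ⟨Q, hQ, hmax⟩ := (Set.toFinite _).exists_maximal hne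
    obtain ⟨p, hp, hpQ⟩ := Set.not_subset.1 hQ.2
    refine ⟨p, hp, fun R hR hpR => ?_⟩
    by_contra hSR
    rcases hchain.total hR hQ.1 with h | h
    · exact hpQ (h hpR)
    · exact hpQ (hmax ⟨hR, hSR⟩ h hpR)
  · obtain ⟨x, y, -, hS⟩ := S.exists_ne
    refine ⟨_, hS, fun R hR _ => ?_⟩
    by_contra hSR
    exact hne ⟨R, hR, hSR⟩

theorem pairMass_injOn [Finite X] :
    Set.InjOn pairMass (orderComplex (NontrivialOrder X)) := by
  classical
  intro t ht t' ht' h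
  refine eq_of_sum_ge_eq fun S => le_antisymm ?_ ?_
  · obtain ⟨p, hp, hS⟩ := exists_pairMass_eq_sum_ge ht'.2.2 S
    rw [← hS, ← h]
    exact sum_ge_le_pairMass ht.1 S hp
  · obtain ⟨p, hp, hS⟩ := exists_pairMass_eq_sum_ge ht.2.2 S
    rw [← hS, h]
    exact sum_ge_le_pairMass ht'.1 S hp

theorem superlevel_isOrder {τ : X × X → ℝ} (hτ : τ ∈ fuzzyOrders X) {u : ℝ}
    (hu : u ∈ Set.Ioc 0 1) : IsOrder {p | u ≤ τ p} ∧ {p | u ≤ τ p} ≠ delta X := by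
  obtain ⟨-, hrefl, htrans, hanti, x, y, hxy, h1⟩ := hτ
  refine ⟨⟨fun x => hu.2.trans_eq (hrefl x).symm, fun x y z h h' => (le_min h h').trans (htrans x y z),
    fun x y h h' => ?_⟩, fun h => hxy ?_⟩
  · by_contra hne
    rw [Set.mem_ofPred_eq] at h h'
    rcases hanti x y hne with h0 | h0 <;> linarith [hu.1]
  · have : (x, y) ∈ {p | u ≤ τ p} := hu.2.trans_eq h1.symm
    rwa [h] at this

open MeasureTheory in
theorem exists_pairMass_eq [Finite X] {τ : X × X → ℝ} (hτ : τ ∈ fuzzyOrders X) :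
    ∃ t ∈ orderComplex (NontrivialOrder X), pairMass t = τ := by
  classical
  let A : NontrivialOrder X → Set ℝ := fun S => {u ∈ Set.Ioc 0 1 | {p | u ≤ τ p} = S.1}
  have hmeas : ∀ S, MeasurableSet (A S) := fun S => by
    have : A S = Set.Ioc 0 1 ∩ ⋂ p, {u | u ≤ τ p ↔ p ∈ S.1} := by
      ext u
      simp [A, Set.ext_iff]
    rw [this]
    refine measurableSet_Ioc.inter (MeasurableSet.iInter fun p => ?_)
    by_cases hp : p ∈ S.1 <;> simp only [hp, iff_true, iff_false, not_le]
    exacts [measurableSet_Iic, measurableSet_Ioi]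
  have hdisj : Pairwise (Function.onFun Disjoint A) := fun S R hSR =>
    Set.disjoint_left.2 fun u hS hR => hSR (Subtype.ext (hS.2.symm.trans hR.2))
  have hsum : ∀ (s : Finset (NontrivialOrder X)) (a : ℝ), 0 ≤ a → a ≤ 1 →
      (∀ u (hu : u ∈ Set.Ioc (0 : ℝ) 1), (⟨_, superlevel_isOrder hτ hu⟩ ∈ s ↔ u ≤ a)) →
      ∑ S ∈ s, volume.real (A S) = a := fun s a ha0 ha1 hs => by
    rw [← measureReal_biUnion_finset (fun S _ R _ h => hdisj h) (fun S _ => hmeas S)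
      fun S _ => ((measure_mono (Set.sep_subset _ _)).trans_lt measure_Ioc_lt_top).ne]
    have : ⋃ S ∈ s, A S = Set.Ioc 0 a := by
      ext u
      simp only [Set.mem_iUnion, exists_prop]
      constructor
      · rintro ⟨S, hS, hu, huS⟩
        refine ⟨hu.1, (hs u hu).1 ?_⟩
        rwa [show (⟨_, superlevel_isOrder hτ hu⟩ : NontrivialOrder X) = S from Subtype.ext huS]
      · intro hu
        have hu' : u ∈ Set.Ioc (0 : ℝ) 1 := ⟨hu.1, hu.2.trans ha1⟩
        exact ⟨_, (hs u hu').2 hu.2, hu', rfl⟩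
    rw [this, Real.volume_real_Ioc_of_le ha0, sub_zero]
  refine ⟨fun S => volume.real (A S), ⟨fun S => measureReal_nonneg, ?_, ?_⟩, funext fun p => ?_⟩
  · rw [finsum_eq_sum_of_fintype]
    exact hsum _ 1 zero_le_one le_rfl fun u hu => by simp [hu.2]
  · intro S hS R hR _
    obtain ⟨u, hu, huS⟩ := nonempty_of_measureReal_ne_zero hS
    obtain ⟨w, hw, hwR⟩ := nonempty_of_measureReal_ne_zero hR
    simp only [← Subtype.coe_le_coe, ← huS, ← hwR]
    exact (le_total w u).imp (fun h p hp => h.trans hp) (fun h p hp => h.trans hp)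
  · exact hsum _ _ (hτ.1 p).1 (hτ.1 p).2 fun u hu => by simp

/-- The order complex of the poset of nontrivial orders on `X` is homeomorphic to the space of
fuzzy orders on `X`. -/
noncomputable def orderComplexHomeomorph [Finite X] :
    orderComplex (NontrivialOrder X) ≃ₜ fuzzyOrders X :=
  have : CompactSpace (orderComplex (NontrivialOrder X)) :=
    isCompact_iff_compactSpace.1 (isCompact_orderComplex _)
  Continuous.homeoOfEquivCompactToT2 (f := Equiv.ofBijective
    (fun t => (⟨pairMass t.1, pairMass_mem t.2⟩ : fuzzyOrders X))
    ⟨fun t t' h => Subtype.ext (pairMass_injOn t.2 t'.2 (congrArg Subtype.val h)), fun τ => by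
      obtain ⟨t, ht, h⟩ := exists_pairMass_eq τ.2
      exact ⟨⟨t, ht⟩, Subtype.ext h⟩⟩)
    ((continuous_pairMass.comp continuous_subtype_val).subtype_mk _)

/-- Theorem 5.4: for `|X| = n ≥ 2`, the poset `Ω_X − {Δ}` of nontrivial orders on `X` has
the homotopy type of a sphere of dimension `n − 2`. -/
theorem nontrivialOrders_homotopyEquiv_sphere {X : Type*} [Fintype X]
    (n : ℕ) (hn : n = Fintype.card X) (h2 : 2 ≤ n) :
    Nonempty ((orderComplex {T : Set (X × X) // IsOrder T ∧ T ≠ delta X}) ≃ₕ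
      (Metric.sphere (0 : EuclideanSpace ℝ (Fin (n - 1))) 1)) := by
  have e : Option (Fin (n - 1)) ≃ X :=
    Fintype.equivOfCardEq (by rw [Fintype.card_option, Fintype.card_fin]; omega)
  exact ⟨orderComplexHomeomorph.toHomotopyEquiv.trans
    ((fuzzyOrdersHomotopyEquiv e).trans (puncturedHomotopyEquivSphere _))⟩
end
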